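/- arXiv:1909.08799 — 3 statements merged into one kernel-verified Lean document; each statement's English description precedes it below -/
import Mathlib

section
/- Van der Corput inequality (Lemma 3.1): Suppose that ‖φ_u‖₂ ≤ 1 for every u ∈ ℝ and that ⟨φ_u, φ_w⟩ = ⟨φ_0, φ_{w−u}⟩ for all u, w ∈ ℝ. Then for every N > 0 and every 0 < L < N one has ‖(1/N) ∫₀^N φ_u du‖₂ ≤ [ (2/N) ∫₀^N ( (1/L) ∫₀^L |⟨φ_u, φ_{u+l}⟩| dl ) du ]^{1/2} + 2·(L/N). -/
open MeasureTheory
open scoped RealInnerProductSpace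

section Stationary

variable {E : Type*} [NormedAddCommGroup E] [InnerProductSpace ℝ E] {φ : ℝ → E}

theorem intervalIntegrable_inner_left
    (hφ : ∀ a b : ℝ, IntervalIntegrable φ volume a b) (x : E) (a b : ℝ) :
    IntervalIntegrable (fun u => ⟪x, φ u⟫) volume a b :=
  ⟨(hφ a b).1.const_inner x, (hφ a b).2.const_inner x⟩

/-- The absolute autocorrelation of a stationary family is even. -/
theorem integral_abs_inner_symm
    (hφ : ∀ a b : ℝ, IntervalIntegrable φ volume a b)
    (hinv : ∀ u w : ℝ, ⟪φ u, φ w⟫ = ⟪φ 0, φ (w - u)⟫) (L : ℝ) :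
    ∫ s in -L..L, |⟪φ 0, φ s⟫| = 2 * ∫ s in (0:ℝ)..L, |⟪φ 0, φ s⟫| := by
  have heven (s : ℝ) : ⟪φ 0, φ (-s)⟫ = ⟪φ 0, φ s⟫ := by
    rw [real_inner_comm (φ s), hinv s 0, zero_sub]
  have hint (a b : ℝ) := (intervalIntegrable_inner_left hφ (φ 0) a b).abs
  have hneg : ∫ s in -L..0, |⟪φ 0, φ s⟫| = ∫ s in (0:ℝ)..L, |⟪φ 0, φ s⟫| := by
    have h := intervalIntegral.integral_comp_neg (a := 0) (b := L) (fun s => |⟪φ 0, φ s⟫|)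
    simp only [heven, neg_zero] at h
    exact h.symm
  rw [← intervalIntegral.integral_add_adjacent_intervals (hint (-L) 0) (hint 0 L), hneg, two_mul]

variable [CompleteSpace E]

theorem abs_inner_integral_block_le
    (hφ : ∀ a b : ℝ, IntervalIntegrable φ volume a b)
    (hinv : ∀ u w : ℝ, ⟪φ u, φ w⟫ = ⟪φ 0, φ (w - u)⟫) {L : ℝ} (hL : 0 ≤ L) {a v : ℝ}
    (hav : a ≤ v) (hva : v ≤ a + L) :
    |⟪φ v, ∫ u in a..a + L, φ u⟫| ≤ 2 * ∫ s in (0:ℝ)..L, |⟪φ 0, φ s⟫| := by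
  have hcomm : ⟪φ v, ∫ u in a..a + L, φ u⟫ = ∫ u in a..a + L, ⟪φ v, φ u⟫ :=
    ((innerSL ℝ (φ v)).intervalIntegral_comp_comm (hφ a (a + L))).symm
  calc |⟪φ v, ∫ u in a..a + L, φ u⟫|
      = |∫ u in a..a + L, ⟪φ v, φ u⟫| := by rw [hcomm]
    _ ≤ ∫ u in a..a + L, |⟪φ v, φ u⟫| :=
        intervalIntegral.abs_integral_le_integral_abs (by linarith)
    _ = ∫ u in a..a + L, |⟪φ 0, φ (u - v)⟫| := by simp only [hinv v]
    _ = ∫ s in (a - v)..(a + L - v), |⟪φ 0, φ s⟫| :=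
        intervalIntegral.integral_comp_sub_right (fun s => |⟪φ 0, φ s⟫|) v
    _ ≤ ∫ s in -L..L, |⟪φ 0, φ s⟫| :=
        intervalIntegral.integral_mono_interval (by linarith) (by linarith) (by linarith)
          (Filter.Eventually.of_forall fun _ => abs_nonneg _)
          (intervalIntegrable_inner_left hφ (φ 0) (-L) L).abs
    _ = 2 * ∫ s in (0:ℝ)..L, |⟪φ 0, φ s⟫| := integral_abs_inner_symm hφ hinv L

theorem norm_integral_block_le
    (hφ : ∀ a b : ℝ, IntervalIntegrable φ volume a b)
    (hinv : ∀ u w : ℝ, ⟪φ u, φ w⟫ = ⟪φ 0, φ (w - u)⟫) {L : ℝ} (hL : 0 ≤ L) (a : ℝ) :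
    ‖∫ u in a..a + L, φ u‖ ≤ √((2 * ∫ s in (0:ℝ)..L, |⟪φ 0, φ s⟫|) * L) := by
  apply Real.le_sqrt_of_sq_le
  set I := ∫ u in a..a + L, φ u with hI
  have hcomm : ⟪I, I⟫ = ∫ v in a..a + L, ⟪I, φ v⟫ :=
    ((innerSL ℝ I).intervalIntegral_comp_comm (hφ a (a + L))).symm
  have hbound := intervalIntegral.norm_integral_le_of_norm_le_const (a := a) (b := a + L)
    (f := fun v => ⟪I, φ v⟫) (C := 2 * ∫ s in (0:ℝ)..L, |⟪φ 0, φ s⟫|) fun v hv => by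
      rw [Set.uIoc_of_le (by linarith)] at hv
      rw [real_inner_comm, Real.norm_eq_abs]
      exact abs_inner_integral_block_le hφ hinv hL hv.1.le hv.2
  rw [add_sub_cancel_left, abs_of_nonneg hL] at hbound
  rw [← real_inner_self_eq_norm_sq, hcomm]
  exact (Real.le_norm_self _).trans hbound

theorem norm_integral_blocks_le
    (hφ : ∀ a b : ℝ, IntervalIntegrable φ volume a b)
    (hinv : ∀ u w : ℝ, ⟪φ u, φ w⟫ = ⟪φ 0, φ (w - u)⟫) {L : ℝ} (hL : 0 ≤ L) (k : ℕ) :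
    ‖∫ u in (0:ℝ)..k * L, φ u‖ ≤ k * √((2 * ∫ s in (0:ℝ)..L, |⟪φ 0, φ s⟫|) * L) := by
  induction k with
  | zero => simp
  | succ k ih =>
    rw [Nat.cast_succ, add_one_mul (k : ℝ) L, add_one_mul (k : ℝ),
      ← intervalIntegral.integral_add_adjacent_intervals (hφ 0 (k * L)) (hφ _ _)]
    exact (norm_add_le _ _).trans (add_le_add ih (norm_integral_block_le hφ hinv hL _))

theorem norm_average_le
    (hφ : ∀ a b : ℝ, IntervalIntegrable φ volume a b) (hnorm : ∀ u : ℝ, ‖φ u‖ ≤ 1)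
    (hinv : ∀ u w : ℝ, ⟪φ u, φ w⟫ = ⟪φ 0, φ (w - u)⟫) {N L : ℝ} (hN : 0 < N) (hL : 0 < L) :
    ‖(1 / N) • ∫ u in (0:ℝ)..N, φ u‖ ≤
      √(2 * ((1 / L) * ∫ s in (0:ℝ)..L, |⟪φ 0, φ s⟫|)) + L / N := by
  set G := ∫ s in (0:ℝ)..L, |⟪φ 0, φ s⟫|
  set k := ⌊N / L⌋₊
  have hkN : k * L ≤ N := (le_div_iff₀ hL).1 (Nat.floor_le (by positivity))
  have hNk : N < (k + 1) * L := (div_lt_iff₀ hL).1 (Nat.lt_floor_add_one _)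
  have hrest : ‖∫ u in (k * L)..N, φ u‖ ≤ L := by
    have h := intervalIntegral.norm_integral_le_of_norm_le_const (a := k * L) (b := N)
      fun u _ => hnorm u
    rw [abs_of_nonneg (by linarith)] at h
    linarith
  have hsqrt : √(2 * G * L) = L * √(2 * ((1 / L) * G)) := by
    rw [show 2 * G * L = L ^ 2 * (2 * ((1 / L) * G)) by field_simp,
      Real.sqrt_mul (sq_nonneg L), Real.sqrt_sq hL.le]
  have hsum : ‖∫ u in (0:ℝ)..N, φ u‖ ≤ N * √(2 * ((1 / L) * G)) + L := by
    rw [← intervalIntegral.integral_add_adjacent_intervals (hφ 0 (k * L)) (hφ _ _)]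
    refine (norm_add_le _ _).trans (add_le_add ?_ hrest)
    refine (norm_integral_blocks_le hφ hinv hL.le k).trans ?_
    rw [hsqrt, ← mul_assoc]
    gcongr
  rw [norm_smul, Real.norm_of_nonneg (by positivity), one_div_mul_eq_div, div_le_iff₀ hN,
    add_mul, div_mul_cancel₀ _ hN.ne', mul_comm _ N]
  exact hsum

end Stationary

/-- **Van der Corput inequality** (Lemma 3.1): if `‖φ u‖₂ ≤ 1` for every `u ∈ ℝ` and
`⟨φ u, φ w⟩ = ⟨φ 0, φ (w - u)⟩` for all `u, w ∈ ℝ`, then for every `N > 0` and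
`0 < L < N`,
`‖(1/N) ∫₀^N φ u du‖₂ ≤ [ (2/N) ∫₀^N ( (1/L) ∫₀^L |⟨φ u, φ (u+l)⟩| dl ) du ]^{1/2} + 2 L/N`. -/
theorem van_der_corput_inequality
    {X : Type*} [MeasurableSpace X] (μ : Measure X)
    (φ : ℝ → Lp ℝ 2 μ)
    (hφmeas : ∀ a b : ℝ, IntervalIntegrable φ MeasureTheory.volume a b)
    (hφnorm : ∀ u : ℝ, ‖φ u‖ ≤ 1)
    (hφinv : ∀ u w : ℝ, ⟪φ u, φ w⟫ = ⟪φ 0, φ (w - u)⟫)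
    (N L : ℝ) (hN : 0 < N) (hL0 : 0 < L) (hLN : L < N) :
    ‖(1 / N) • ∫ u in (0:ℝ)..N, φ u‖ ≤
      Real.sqrt ((2 / N) * ∫ u in (0:ℝ)..N,
          (1 / L) * ∫ l in (0:ℝ)..L, |⟪φ u, φ (u + l)⟫|)
        + 2 * (L / N) := by
  have hstat (u l : ℝ) : ⟪φ u, φ (u + l)⟫ = ⟪φ 0, φ l⟫ := by
    rw [hφinv u, add_sub_cancel_left]
  simp only [hstat, intervalIntegral.integral_const, sub_zero, smul_eq_mul]
  rw [← mul_assoc, div_mul_cancel₀ _ hN.ne']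
  refine (norm_average_le hφmeas hφnorm hφinv hN hL0).trans ?_
  have : 0 ≤ L / N := by positivity
  linarith
end

section
/- Second step of the proof of the van der Corput inequality: Suppose that ⟨φ_u, φ_w⟩ = ⟨φ_0, φ_{w−u}⟩ for all u, w ∈ ℝ. Then for every N > 0 and every 0 < L < N one has ‖(1/N) ∫₀^N ( (1/L) ∫₀^L φ_{u+l} dl ) du‖₂ ≤ [ (2/N) ∫₀^N ( (1/L) ∫₀^L |⟨φ_u, φ_{u+l}⟩| dl ) du ]^{1/2}. -/
open MeasureTheory
open scoped RealInnerProductSpace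

/-- The integral of an even function over any interval of length `L` meeting the origin is at most
twice its integral over `[0, L]`, for nonnegative functions. -/
theorem intervalIntegral_sub_le_two_mul_of_even {g : ℝ → ℝ}
    (hg : ∀ a b : ℝ, IntervalIntegrable g volume a b) (hg0 : ∀ x, 0 ≤ g x)
    (hge : ∀ x, g (-x) = g x) {L l : ℝ} (hl : l ∈ Set.Icc 0 L) :
    ∫ x in (0:ℝ)..L, g (x - l) ≤ 2 * ∫ x in (0:ℝ)..L, g x := by
  have hmono : ∀ t ∈ Set.Icc 0 L, ∫ x in (0:ℝ)..t, g x ≤ ∫ x in (0:ℝ)..L, g x := fun t ht =>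
    intervalIntegral.integral_mono_interval le_rfl ht.1 ht.2
      (Filter.Eventually.of_forall hg0) (hg 0 L)
  have hneg : ∫ x in (-l)..0, g x = ∫ x in (0:ℝ)..l, g x := by
    simpa [hge] using (intervalIntegral.integral_comp_neg (a := 0) (b := l) g).symm
  rw [intervalIntegral.integral_comp_sub_right, zero_sub,
    ← intervalIntegral.integral_add_adjacent_intervals (hg (-l) 0) (hg 0 (L - l)), hneg]
  linarith [hmono l hl, hmono (L - l) ⟨by linarith [hl.2], by linarith [hl.1]⟩]

section Stationary

variable {H : Type*} [NormedAddCommGroup H] [InnerProductSpace ℝ H] {φ : ℝ → H}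

theorem intervalIntegral_real_inner [CompleteSpace H] {f : ℝ → H} {a b : ℝ}
    (hf : IntervalIntegrable f volume a b) (x : H) :
    ∫ t in a..b, ⟪x, f t⟫ = ⟪x, ∫ t in a..b, f t⟫ :=
  (innerSL ℝ x).intervalIntegral_comp_comm hf

/-- Norm bound for the integral of a stationary family of vectors over an interval. -/
theorem norm_sq_intervalIntegral_le_of_stationary [CompleteSpace H]
    (hφ : ∀ a b : ℝ, IntervalIntegrable φ volume a b)
    (hinv : ∀ u w : ℝ, ⟪φ u, φ w⟫ = ⟪φ 0, φ (w - u)⟫) {L : ℝ} (hL : 0 ≤ L) (u : ℝ) :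
    ‖∫ l in (0:ℝ)..L, φ (u + l)‖ ^ 2 ≤ 2 * (∫ l in (0:ℝ)..L, |⟪φ 0, φ l⟫|) * L := by
  have hc : ∀ a b : ℝ, IntervalIntegrable (fun l => |⟪φ 0, φ l⟫|) volume a b := fun a b =>
    IntervalIntegrable.abs ⟨(hφ a b).1.const_inner (φ 0), (hφ a b).2.const_inner (φ 0)⟩
  have heven : ∀ x : ℝ, |⟪φ 0, φ (-x)⟫| = |⟪φ 0, φ x⟫| := fun x => by
    rw [← zero_sub x, ← hinv x 0, real_inner_comm]
  have hshift : IntervalIntegrable (fun l => φ (u + l)) volume 0 L := by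
    simpa using (hφ (u + 0) (u + L)).comp_add_left u
  set w := ∫ l in (0:ℝ)..L, φ (u + l) with hw
  have hbound : ∀ l ∈ Set.uIoc 0 L, ‖⟪w, φ (u + l)⟫‖ ≤ 2 * ∫ l in (0:ℝ)..L, |⟪φ 0, φ l⟫| := by
    intro l hl
    rw [Set.uIoc_of_le hL] at hl
    rw [real_inner_comm, hw, ← intervalIntegral_real_inner hshift, Real.norm_eq_abs]
    refine (intervalIntegral.abs_integral_le_integral_abs hL).trans ?_
    have hcongr : ∀ x, |⟪φ (u + l), φ (u + x)⟫| = |⟪φ 0, φ (x - l)⟫| := fun x => by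
      rw [hinv, add_sub_add_left_eq_sub]
    simp only [hcongr]
    exact intervalIntegral_sub_le_two_mul_of_even hc (fun _ => abs_nonneg _) heven
      ⟨hl.1.le, hl.2⟩
  have h := intervalIntegral.norm_integral_le_of_norm_le_const hbound
  rw [intervalIntegral_real_inner hshift, ← hw, real_inner_self_eq_norm_sq, sub_zero,
    abs_of_nonneg hL] at h
  exact (le_abs_self _).trans h

end Stationary

/-- Second step of the proof of the van der Corput inequality: if
`⟨φ u, φ w⟩ = ⟨φ 0, φ (w - u)⟩` for all `u, w`, then for every `N > 0` and `0 < L < N`,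
`‖(1/N) ∫₀^N ( (1/L) ∫₀^L φ (u+l) dl ) du‖₂
  ≤ [ (2/N) ∫₀^N ( (1/L) ∫₀^L |⟨φ u, φ (u+l)⟩| dl ) du ]^{1/2}`. -/
theorem van_der_corput_step_two
    {X : Type*} [MeasurableSpace X] (μ : Measure X)
    (φ : ℝ → Lp ℝ 2 μ)
    (hφmeas : ∀ a b : ℝ, IntervalIntegrable φ MeasureTheory.volume a b)
    (hφbdd : ∀ a b : ℝ, ∃ C : ℝ, ∀ u ∈ Set.Icc a b, ‖φ u‖ ≤ C)
    (hφinv : ∀ u w : ℝ, ⟪φ u, φ w⟫ = ⟪φ 0, φ (w - u)⟫)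
    (N L : ℝ) (hN : 0 < N) (hL0 : 0 < L) (hLN : L < N) :
    ‖(1 / N) • ∫ u in (0:ℝ)..N, (1 / L) • ∫ l in (0:ℝ)..L, φ (u + l)‖ ≤
      Real.sqrt ((2 / N) * ∫ u in (0:ℝ)..N,
        (1 / L) * ∫ l in (0:ℝ)..L, |⟪φ u, φ (u + l)⟫|) := by
  set J := ∫ l in (0:ℝ)..L, |⟪φ 0, φ l⟫| with hJ
  have hrhs : (2 / N) * ∫ u in (0:ℝ)..N, (1 / L) * ∫ l in (0:ℝ)..L, |⟪φ u, φ (u + l)⟫|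
      = 2 * J / L := by
    have hcongr : ∀ u l : ℝ, |⟪φ u, φ (u + l)⟫| = |⟪φ 0, φ l⟫| := fun u l => by
      rw [hφinv, add_sub_cancel_left]
    simp only [hcongr, ← hJ, intervalIntegral.integral_const, smul_eq_mul, sub_zero]
    field_simp
  rw [hrhs]
  have hbound : ∀ u ∈ Set.uIoc 0 N, ‖(1 / L) • ∫ l in (0:ℝ)..L, φ (u + l)‖ ≤ √(2 * J / L) := by
    intro u _
    apply Real.le_sqrt_of_sq_le
    rw [norm_smul, mul_pow, Real.norm_eq_abs, sq_abs]
    calc (1 / L) ^ 2 * ‖∫ l in (0:ℝ)..L, φ (u + l)‖ ^ 2 ≤ (1 / L) ^ 2 * (2 * J * L) := by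
          gcongr
          exact norm_sq_intervalIntegral_le_of_stationary hφmeas hφinv hL0.le u
      _ = 2 * J / L := by field_simp
  have h := intervalIntegral.norm_integral_le_of_norm_le_const hbound
  rw [sub_zero, abs_of_pos hN] at h
  rw [norm_smul, Real.norm_eq_abs, abs_of_pos (by positivity), one_div, inv_mul_le_iff₀ hN,
    mul_comm N]
  exact h
end

section
/- Invariant measure of the time-changed flow: for every t ∈ ℝ the time-changed map φ^τ_t preserves the measure with density τ, i.e. for every measurable set A ⊆ X one has ∫_{(φ^τ_t)^{−1}(A)} τ dμ = ∫_A τ dμ. In particular, φ^τ_t preserves the probability measure μ^τ defined by dμ^τ = (τ / ∫_X τ dμ) dμ. -/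
open MeasureTheory

/-- The measure with density `g` of a half-open interval. -/
lemma withDensity_ofReal_Ioc {g : ℝ → ℝ} (hg : LocallyIntegrable g) (h_nonneg : ∀ s, 0 ≤ g s)
    (a b : ℝ) :
    (volume.withDensity fun s => ENNReal.ofReal (g s)) (Set.Ioc a b)
      = ENNReal.ofReal (∫ s in a..b, g s) := by
  have hi : ∀ a b : ℝ, IntervalIntegrable g volume a b := fun a b =>
    (hg.integrableOn_isCompact isCompact_uIcc).intervalIntegrable
  rcases le_total a b with hab | hab
  · rw [withDensity_apply _ measurableSet_Ioc, intervalIntegral.integral_of_le hab,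
      ofReal_integral_eq_lintegral_ofReal (hi a b).1 (ae_of_all _ h_nonneg)]
  · rw [Set.Ioc_eq_empty_of_le hab, measure_empty, intervalIntegral.integral_symm, eq_comm,
      ENNReal.ofReal_eq_zero, neg_nonpos]
    exact intervalIntegral.integral_nonneg hab fun s _ => h_nonneg s

/-- A map of the line that moves every point by a fixed amount `t` of `g`-mass is strictly
monotone. -/
lemma strictMono_of_integral_eq {g : ℝ → ℝ} (hg : LocallyIntegrable g) (h_pos : ∀ s, 0 < g s)
    {h : ℝ → ℝ} {t : ℝ} (hh : ∀ s, ∫ r in s..h s, g r = t) : StrictMono h := by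
  have hi : ∀ a b : ℝ, IntervalIntegrable g volume a b := fun a b =>
    (hg.integrableOn_isCompact isCompact_uIcc).intervalIntegrable
  intro a b hab
  by_contra! hle
  have h₁ : 0 < ∫ r in a..b, g r :=
    intervalIntegral.intervalIntegral_pos_of_pos (hi a b) h_pos hab
  have h₂ : 0 ≤ ∫ r in h b..h a, g r :=
    intervalIntegral.integral_nonneg hle fun s _ => (h_pos s).le
  have h₃ := intervalIntegral.integral_add_adjacent_intervals (hi a b) (hi b (h b))
  have h₄ := intervalIntegral.integral_add_adjacent_intervals (hi a (h b)) (hi (h b) (h a))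
  linarith [hh a, hh b]

/-- A map of the line onto itself that moves every point by a fixed amount `t` of `g`-mass
preserves the measure with density `g`. -/
lemma measurePreserving_of_integral_eq {g : ℝ → ℝ} (hg : LocallyIntegrable g)
    (h_pos : ∀ s, 0 < g s) {h : ℝ → ℝ} {t : ℝ} (hh : ∀ s, ∫ r in s..h s, g r = t)
    (h_surj : Function.Surjective h) :
    MeasurePreserving h (volume.withDensity fun s => ENNReal.ofReal (g s))
      (volume.withDensity fun s => ENNReal.ofReal (g s)) := by
  have hi : ∀ a b : ℝ, IntervalIntegrable g volume a b := fun a b =>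
    (hg.integrableOn_isCompact isCompact_uIcc).intervalIntegrable
  have h_mono := strictMono_of_integral_eq hg h_pos hh
  refine ⟨h_mono.monotone.measurable, Eq.symm ?_⟩
  have : IsLocallyFiniteMeasure (volume.withDensity fun s => ENNReal.ofReal (g s)) := by
    refine ⟨fun s => ⟨Set.Ioc (s - 1) (s + 1), Ioc_mem_nhds (by linarith) (by linarith), ?_⟩⟩
    rw [withDensity_ofReal_Ioc hg fun s => (h_pos s).le]
    exact ENNReal.ofReal_lt_top
  refine Measure.ext_of_Ioc _ _ fun a b _ => ?_
  obtain ⟨a, rfl⟩ := h_surj a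
  obtain ⟨b, rfl⟩ := h_surj b
  have h_pre : h ⁻¹' Set.Ioc (h a) (h b) = Set.Ioc a b := by
    ext s
    simp [h_mono.lt_iff_lt, h_mono.le_iff_le]
  rw [Measure.map_apply h_mono.monotone.measurable measurableSet_Ioc, h_pre,
    withDensity_ofReal_Ioc hg fun s => (h_pos s).le,
    withDensity_ofReal_Ioc hg fun s => (h_pos s).le]
  congr 1
  have h₃ := intervalIntegral.integral_add_adjacent_intervals (hi a b) (hi b (h b))
  have h₄ := intervalIntegral.integral_add_adjacent_intervals (hi a (h a)) (hi (h a) (h b))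
  linarith [hh a, hh b]

/-- Moving every point by an amount `t` of `g`-mass changes the mass of a set inside a window
by at most `2 |t|`. -/
lemma withDensity_preimage_inter_Ioc_le {g : ℝ → ℝ} (hg : LocallyIntegrable g)
    (h_pos : ∀ s, 0 < g s) {h : ℝ → ℝ} {t : ℝ} (hh : ∀ s, ∫ r in s..h s, g r = t)
    (h_surj : Function.Surjective h) {B : Set ℝ} (hB : MeasurableSet B) (a b : ℝ) :
    (volume.withDensity fun s => ENNReal.ofReal (g s)) (h ⁻¹' B ∩ Set.Ioc a b)
      ≤ (volume.withDensity fun s => ENNReal.ofReal (g s)) (B ∩ Set.Ioc a b)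
        + ENNReal.ofReal (2 * |t|) := by
  have h_mono := strictMono_of_integral_eq hg h_pos hh
  have h_pre : h ⁻¹' B ∩ Set.Ioc a b = h ⁻¹' (B ∩ Set.Ioc (h a) (h b)) := by
    ext s
    simp [h_mono.lt_iff_lt, h_mono.le_iff_le]
  rw [h_pre, (measurePreserving_of_integral_eq hg h_pos hh h_surj).measure_preimage
    (hB.inter measurableSet_Ioc).nullMeasurableSet]
  have h_sub : B ∩ Set.Ioc (h a) (h b)
      ⊆ B ∩ Set.Ioc a b ∪ (Set.Ioc (h a) a ∪ Set.Ioc b (h b)) := by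
    rintro s ⟨hs, h₁, h₂⟩
    by_cases h₃ : s ≤ a
    · exact Or.inr (Or.inl ⟨h₁, h₃⟩)
    by_cases h₄ : s ≤ b
    · exact Or.inl ⟨hs, not_le.1 h₃, h₄⟩
    · exact Or.inr (Or.inr ⟨not_le.1 h₄, h₂⟩)
  refine (measure_mono h_sub).trans ((measure_union_le _ _).trans ?_)
  gcongr
  refine (measure_union_le _ _).trans ?_
  rw [withDensity_ofReal_Ioc hg fun s => (h_pos s).le,
    withDensity_ofReal_Ioc hg fun s => (h_pos s).le, intervalIntegral.integral_symm, hh, hh,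
    two_mul, ENNReal.ofReal_add (abs_nonneg t) (abs_nonneg t)]
  gcongr
  exacts [neg_le_abs t, le_abs_self t]

/-- Averaging an integral over orbit segments of a measure-preserving flow. -/
lemma lintegral_orbit_average {X : Type*} [MeasurableSpace X] {μ : Measure X} [SFinite μ]
    {φ : ℝ → X → X} (hφmeas : Measurable fun p : ℝ × X => φ p.1 p.2)
    (hφinv : ∀ t : ℝ, MeasurePreserving (φ t) μ μ) {f : X → ENNReal} (hf : Measurable f)
    (a b : ℝ) :
    ∫⁻ x, (∫⁻ s in Set.Ioc a b, f (φ s x)) ∂μ = ENNReal.ofReal (b - a) * ∫⁻ x, f x ∂μ := by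
  rw [lintegral_lintegral_swap (f := fun x s => f (φ s x)) (hf.comp (hφmeas.comp measurable_swap)).aemeasurable]
  simp_rw [fun s => (hφinv s).lintegral_comp hf]
  rw [setLIntegral_const, Real.volume_Ioc, mul_comm]

/-- If a measurable map of `X` acts on every orbit of a measure-preserving flow by moving points
by a fixed amount of `τ`-mass, then it does not increase the measure with density `τ`. -/
lemma withDensity_preimage_le_of_orbit {X : Type*} [MeasurableSpace X] {μ : Measure X}
    [IsProbabilityMeasure μ] {φ : ℝ → X → X} (hφmeas : Measurable fun p : ℝ × X => φ p.1 p.2)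
    (hφinv : ∀ t : ℝ, MeasurePreserving (φ t) μ μ) {τ : X → ℝ} (hτmeas : Measurable τ)
    (hτpos : ∀ x, 0 < τ x) (hτint : ∀ x, LocallyIntegrable fun s => τ (φ s x)) {T : X → X}
    (hT : Measurable T) {h : X → ℝ → ℝ} {t : ℝ} (hTh : ∀ x s, T (φ s x) = φ (h x s) x)
    (hh : ∀ x s, ∫ r in s..h x s, τ (φ r x) = t) (h_surj : ∀ x, Function.Surjective (h x))
    {A : Set X} (hA : MeasurableSet A) :
    (μ.withDensity fun x => ENNReal.ofReal (τ x)) (T ⁻¹' A)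
      ≤ (μ.withDensity fun x => ENNReal.ofReal (τ x)) A := by
  have h_window : ∀ {E : Set X}, MeasurableSet E → ∀ n : ℕ,
      (n : ENNReal) * (μ.withDensity fun x => ENNReal.ofReal (τ x)) E
        = ∫⁻ x, (volume.withDensity fun s => ENNReal.ofReal (τ (φ s x)))
            ((fun s => φ s x) ⁻¹' E ∩ Set.Ioc 0 (n : ℝ)) ∂μ := by
    intro E hE n
    have h_avg := lintegral_orbit_average hφmeas hφinv
      (hτmeas.ennreal_ofReal.indicator hE) 0 (n : ℝ)
    rw [lintegral_indicator hE, sub_zero, ENNReal.ofReal_natCast] at h_avg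
    rw [withDensity_apply _ hE, ← h_avg]
    refine lintegral_congr fun x => ?_
    have hE' : MeasurableSet ((fun s => φ s x) ⁻¹' E) := hφmeas.of_uncurry_right hE
    rw [withDensity_apply _ (hE'.inter measurableSet_Ioc), ← Measure.restrict_restrict hE',
      ← lintegral_indicator hE']
    rfl
  have h_le : ∀ n : ℕ, (n : ENNReal) * (μ.withDensity fun x => ENNReal.ofReal (τ x)) (T ⁻¹' A)
      ≤ n * (μ.withDensity fun x => ENNReal.ofReal (τ x)) A + ENNReal.ofReal (2 * |t|) := by
    intro n
    rw [h_window (hT hA), h_window hA]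
    calc _ ≤ ∫⁻ x, ((volume.withDensity fun s => ENNReal.ofReal (τ (φ s x)))
            ((fun s => φ s x) ⁻¹' A ∩ Set.Ioc 0 (n : ℝ)) + ENNReal.ofReal (2 * |t|)) ∂μ := by
          refine lintegral_mono fun x => ?_
          have h_pre : (fun s => φ s x) ⁻¹' (T ⁻¹' A) = h x ⁻¹' ((fun s => φ s x) ⁻¹' A) := by
            ext s
            simp [hTh]
          rw [h_pre]
          exact withDensity_preimage_inter_Ioc_le (hτint x) (fun s => hτpos _) (hh x) (h_surj x)
            (hφmeas.of_uncurry_right hA) 0 n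
      _ = _ := by simp [lintegral_add_right _ measurable_const]
  refine ENNReal.le_of_forall_pos_le_add fun ε hε _ => ?_
  obtain ⟨n, hn⟩ := ENNReal.exists_nat_mul_gt (ENNReal.coe_pos.2 hε).ne'
    (ENNReal.ofReal_ne_top (r := 2 * |t|))
  have hn₀ : (n : ENNReal) ≠ 0 := by
    rintro h₀
    simp [h₀] at hn
  rw [← ENNReal.mul_le_mul_iff_right hn₀ (ENNReal.natCast_ne_top n), mul_add]
  exact (h_le n).trans (by gcongr)

/-- Invariant measure of the time-changed flow: if each `φ_t` preserves the probability
measure `μ` and `φ^τ_t x := φ_{u x t} x` is the time change generated by `τ` (with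
`0 < c ≤ τ ≤ C`), then for every `t` the map `φ^τ_t` preserves the measure with density `τ`:
`∫_{(φ^τ_t)⁻¹ A} τ dμ = ∫_A τ dμ` for every measurable `A`; in particular `φ^τ_t` preserves
the probability measure `μ^τ` with density `τ / ∫_X τ dμ` with respect to `μ`. -/
theorem time_change_invariant_measure
    {X : Type*} [MeasurableSpace X] (μ : Measure X) [IsProbabilityMeasure μ]
    (φ : ℝ → X → X) (hφmeas : Measurable fun p : ℝ × X => φ p.1 p.2)
    (hφ0 : ∀ x, φ 0 x = x) (hφadd : ∀ s t : ℝ, ∀ x, φ (t + s) x = φ t (φ s x))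
    (hφinv : ∀ t : ℝ, MeasurePreserving (φ t) μ μ)
    (τ : X → ℝ) (hτmeas : Measurable τ)
    (c C : ℝ) (hc : 0 < c) (hcC : c ≤ C)
    (hτbd : ∀ x, c ≤ τ x ∧ τ x ≤ C)
    (u : X → ℝ → ℝ)
    (hu : ∀ (x : X) (t : ℝ), (∫ s in (0:ℝ)..(u x t), τ (φ s x)) = t)
    (humeas : ∀ t : ℝ, Measurable fun x => u x t) :
    ∀ t : ℝ,
      (∀ A : Set X, MeasurableSet A →
        ∫ x in (fun x => φ (u x t) x) ⁻¹' A, τ x ∂μ = ∫ x in A, τ x ∂μ) ∧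
      MeasurePreserving (fun x => φ (u x t) x)
        (μ.withDensity fun x => ENNReal.ofReal (τ x / ∫ y, τ y ∂μ))
        (μ.withDensity fun x => ENNReal.ofReal (τ x / ∫ y, τ y ∂μ)) := by
  have hτpos : ∀ x, 0 < τ x := fun x => hc.trans_le (hτbd x).1
  have hτint : ∀ x, LocallyIntegrable fun s => τ (φ s x) := fun x =>
    (locallyIntegrable_const C).mono
      (hτmeas.comp hφmeas.of_uncurry_right).aestronglyMeasurable
      (ae_of_all _ fun s => by
        rw [Real.norm_of_nonneg (hτpos _).le]
        exact (hτbd _).2.trans (le_abs_self C))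
  have hi : ∀ x (a b : ℝ), IntervalIntegrable (fun s => τ (φ s x)) volume a b := fun x a b =>
    ((hτint x).integrableOn_isCompact isCompact_uIcc).intervalIntegrable
  have hτμ : Integrable τ μ := Integrable.of_bound hτmeas.aestronglyMeasurable C
    (ae_of_all _ fun x => by
      rw [Real.norm_of_nonneg (hτpos x).le]
      exact (hτbd x).2)
  have : IsFiniteMeasure (μ.withDensity fun x => ENNReal.ofReal (τ x)) :=
    isFiniteMeasure_withDensity_ofReal hτμ.2
  intro t
  have hT : Measurable fun x => φ (u x t) x := hφmeas.comp ((humeas t).prodMk measurable_id)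
  have hh : ∀ (x : X) (t s : ℝ), ∫ r in s..(u (φ s x) t + s), τ (φ r x) = t := by
    intro x t s
    have := hu (φ s x) t
    simp_rw [← hφadd] at this
    rw [intervalIntegral.integral_comp_add_right (fun r => τ (φ r x)), zero_add] at this
    exact this
  have h_surj : ∀ x, Function.Surjective fun s => u (φ s x) t + s := by
    intro x r
    refine ⟨u (φ r x) (-t) + r, ?_⟩
    set s := u (φ r x) (-t) + r with hs
    have h₁ := hh x (-t) r
    have h₂ := hh x t s
    rw [← hs] at h₁
    have h₃ := intervalIntegral.integral_add_adjacent_intervals (hi x r s)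
      (hi x s (u (φ s x) t + s))
    rw [h₁, h₂, neg_add_cancel] at h₃
    rcases lt_trichotomy (u (φ s x) t + s) r with hlt | heq | hlt
    · have := intervalIntegral.intervalIntegral_pos_of_pos (hi x _ _) (fun r => hτpos _) hlt
      rw [intervalIntegral.integral_symm] at this
      linarith
    · exact heq
    · have := intervalIntegral.intervalIntegral_pos_of_pos (hi x _ _) (fun r => hτpos _) hlt
      linarith
  have h_le : ∀ {A : Set X}, MeasurableSet A →
      (μ.withDensity fun x => ENNReal.ofReal (τ x)) ((fun x => φ (u x t) x) ⁻¹' A)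
        ≤ (μ.withDensity fun x => ENNReal.ofReal (τ x)) A := fun hA =>
    withDensity_preimage_le_of_orbit hφmeas hφinv hτmeas hτpos hτint hT
      (fun x s => (hφadd _ _ _).symm) (fun x s => hh x t s) h_surj hA
  have h_eq : MeasurePreserving (fun x => φ (u x t) x)
      (μ.withDensity fun x => ENNReal.ofReal (τ x))
      (μ.withDensity fun x => ENNReal.ofReal (τ x)) := by
    refine ⟨hT, Measure.eq_of_le_of_measure_univ_eq (Measure.le_iff.2 fun A hA => ?_) ?_⟩
    · rw [Measure.map_apply hT hA]
      exact h_le hA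
    · rw [Measure.map_apply hT MeasurableSet.univ, Set.preimage_univ]
  refine ⟨fun A hA => ?_, ?_⟩
  · have := h_eq.measure_preimage hA.nullMeasurableSet
    rw [withDensity_apply _ (hT hA), withDensity_apply _ hA] at this
    rw [integral_eq_lintegral_of_nonneg_ae (ae_of_all _ fun x => (hτpos x).le)
        hτmeas.aestronglyMeasurable, this,
      integral_eq_lintegral_of_nonneg_ae (ae_of_all _ fun x => (hτpos x).le)
        hτmeas.aestronglyMeasurable]
  · have h_smul : (μ.withDensity fun x => ENNReal.ofReal (τ x / ∫ y, τ y ∂μ))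
        = ENNReal.ofReal (∫ y, τ y ∂μ)⁻¹ • μ.withDensity fun x => ENNReal.ofReal (τ x) := by
      rw [← withDensity_smul _ hτmeas.ennreal_ofReal]
      congr 1
      ext x
      rw [div_eq_mul_inv, ENNReal.ofReal_mul (hτpos x).le, mul_comm]
      rfl
    rw [h_smul]
    exact h_eq.smul_measure _
end
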